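/- (Binary Darboux transformation for the dpKP equation.) Let a_1, a_2, a_3 be complex numbers with a_i ≠ a_j for i ≠ j and all a_i ≠ 0, let v : ℤ³ × ℝ → ℂ be smooth in x and satisfy the dpKP equation at every lattice point and every x. Let θ be nowhere vanishing, smooth, satisfying a_i θ_i − a_j θ_j = (v_j − v_i + a_i − a_j)θ for 1 ≤ i < j ≤ 3 and θ_x = a_i θ_i + (v_i − v − a_i)θ for i = 1,2,3; let ρ be nowhere vanishing, smooth, satisfying a_i ρ_ī − a_j ρ_j̄ = (v_j̄ − v_ī + a_i − a_j)ρ for 1 ≤ i < j ≤ 3 and ρ_x = −a_i ρ_ī + (v_ī − v + a_i)ρ for i = 1,2,3; and let ω be smooth, nowhere vanishing, satisfying a_i(ω_i − ω) = θρ_i for i = 1,2,3 and ω_x = θρ. Then v̂ := v + θρ/ω satisfies the dpKP equation at every lattice point and every x. -/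

import Mathlib

noncomputable section

/-- Forward shift in the `i`-th discrete direction of `ℤ³`. -/
def fwd (i : Fin 3) (n : Fin 3 → ℤ) : Fin 3 → ℤ := Function.update n i (n i + 1)

/-- Backward shift in the `i`-th discrete direction of `ℤ³`. -/
def bwd (i : Fin 3) (n : Fin 3 → ℤ) : Fin 3 → ℤ := Function.update n i (n i - 1)

/-- The discrete potential KP (dpKP) equation
`(v_2−v_1+a_1−a_2)(v_{23}−v_{12}+a_1−a_3) = (v_3−v_1+a_1−a_3)(v_{23}−v_{13}+a_1−a_2)`,
at every lattice point and every `x`. -/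
def dpKP (a : Fin 3 → ℂ) (v : (Fin 3 → ℤ) → ℝ → ℂ) : Prop :=
  ∀ n x,
    (v (fwd 1 n) x - v (fwd 0 n) x + a 0 - a 1)
        * (v (fwd 1 (fwd 2 n)) x - v (fwd 0 (fwd 1 n)) x + a 0 - a 2)
      = (v (fwd 2 n) x - v (fwd 0 n) x + a 0 - a 2)
        * (v (fwd 1 (fwd 2 n)) x - v (fwd 0 (fwd 2 n)) x + a 0 - a 1)

theorem fwd_comm (i j : Fin 3) (n : Fin 3 → ℤ) : fwd i (fwd j n) = fwd j (fwd i n) := by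
  rcases eq_or_ne i j with rfl | h
  · rfl
  · simp [fwd, h, h.symm, Function.update_comm h]

theorem bwd_fwd (i : Fin 3) (n : Fin 3 → ℤ) : bwd i (fwd i n) = n := by
  simp [fwd, bwd]

/-- Under the binary Darboux transformation, the factor `v_j − v_i + a_i − a_j` is multiplied
by `ω ω_{ij} / (ω_i ω_j)`. -/
theorem darboux_factor {a : Fin 3 → ℂ} (ha0 : ∀ i, a i ≠ 0)
    {v θ ρ ω : (Fin 3 → ℤ) → ℝ → ℂ}
    (hθx : ∀ i : Fin 3, ∀ n x,
      deriv (θ n) x = a i * θ (fwd i n) x + (v (fwd i n) x - v n x - a i) * θ n x)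
    (hρx : ∀ i : Fin 3, ∀ n x,
      deriv (ρ n) x = -(a i) * ρ (bwd i n) x + (v (bwd i n) x - v n x + a i) * ρ n x)
    (hω0 : ∀ n x, ω n x ≠ 0)
    (hωd : ∀ i : Fin 3, ∀ n x, a i * (ω (fwd i n) x - ω n x) = θ n x * ρ (fwd i n) x)
    (i j : Fin 3) (n : Fin 3 → ℤ) (x : ℝ) :
    (v (fwd j n) x + θ (fwd j n) x * ρ (fwd j n) x / ω (fwd j n) x)
        - (v (fwd i n) x + θ (fwd i n) x * ρ (fwd i n) x / ω (fwd i n) x) + a i - a j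
      = (v (fwd j n) x - v (fwd i n) x + a i - a j)
        * (ω n x * ω (fwd i (fwd j n)) x / (ω (fwd i n) x * ω (fwd j n) x)) := by
  have hθ : a i * θ (fwd i n) x - a j * θ (fwd j n) x
      = (v (fwd j n) x - v (fwd i n) x + a i - a j) * θ n x := by
    linear_combination hθx j n x - hθx i n x
  have hρ : a i * ρ (fwd j n) x - a j * ρ (fwd i n) x
      = (v (fwd j n) x - v (fwd i n) x + a i - a j) * ρ (fwd i (fwd j n)) x := by
    have hi := hρx i (fwd i (fwd j n)) x
    have hj := hρx j (fwd i (fwd j n)) x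
    rw [bwd_fwd] at hi
    rw [fwd_comm i j, bwd_fwd, ← fwd_comm i j] at hj
    linear_combination hi - hj
  have key : (v (fwd j n) x - v (fwd i n) x + a i - a j) * (ω (fwd i n) x * ω (fwd j n) x)
        + θ (fwd j n) x * ρ (fwd j n) x * ω (fwd i n) x
        - θ (fwd i n) x * ρ (fwd i n) x * ω (fwd j n) x
      = (v (fwd j n) x - v (fwd i n) x + a i - a j) * (ω n x * ω (fwd i (fwd j n)) x) := by
    apply mul_left_cancel₀ (ha0 i)
    linear_combination
      ((v (fwd j n) x - v (fwd i n) x + a i - a j) * ω (fwd j n) x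
          + θ (fwd j n) x * ρ (fwd j n) x) * hωd i n x
        - θ (fwd j n) x * ρ (fwd i n) x * hωd j n x
        - (v (fwd j n) x - v (fwd i n) x + a i - a j) * ω n x * hωd i (fwd j n) x
        - ρ (fwd i n) x * ω (fwd j n) x * hθ + ω n x * θ (fwd j n) x * hρ
  have hi := hω0 (fwd i n) x
  have hj := hω0 (fwd j n) x
  field_simp
  linear_combination key

/-- Binary Darboux transformation for the dpKP equation: if `v` solves dpKP, `θ` is a
nowhere-vanishing solution of the forward linear system, `ρ` a nowhere-vanishing solution
of the backward linear system, and `ω` a nowhere-vanishing potential with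
`a_i(ω_i − ω) = θ ρ_i` and `ω_x = θρ`, then `v̂ = v + θρ/ω` solves the dpKP equation. -/
theorem binary_darboux_dpKP
    (a : Fin 3 → ℂ) (ha : ∀ i j : Fin 3, i ≠ j → a i ≠ a j) (ha0 : ∀ i, a i ≠ 0)
    (v θ ρ ω : (Fin 3 → ℤ) → ℝ → ℂ)
    (hvsmooth : ∀ n, ContDiff ℝ (⊤ : ℕ∞) (v n))
    (hv : dpKP a v)
    (hθ0 : ∀ n x, θ n x ≠ 0)
    (hθsmooth : ∀ n, ContDiff ℝ (⊤ : ℕ∞) (θ n))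
    (hθd : ∀ i j : Fin 3, i < j → ∀ n x,
      a i * θ (fwd i n) x - a j * θ (fwd j n) x
        = (v (fwd j n) x - v (fwd i n) x + a i - a j) * θ n x)
    (hθx : ∀ i : Fin 3, ∀ n x,
      deriv (θ n) x = a i * θ (fwd i n) x + (v (fwd i n) x - v n x - a i) * θ n x)
    (hρ0 : ∀ n x, ρ n x ≠ 0)
    (hρsmooth : ∀ n, ContDiff ℝ (⊤ : ℕ∞) (ρ n))
    (hρd : ∀ i j : Fin 3, i < j → ∀ n x,
      a i * ρ (bwd i n) x - a j * ρ (bwd j n) x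
        = (v (bwd j n) x - v (bwd i n) x + a i - a j) * ρ n x)
    (hρx : ∀ i : Fin 3, ∀ n x,
      deriv (ρ n) x = -(a i) * ρ (bwd i n) x + (v (bwd i n) x - v n x + a i) * ρ n x)
    (hωsmooth : ∀ n, ContDiff ℝ (⊤ : ℕ∞) (ω n))
    (hω0 : ∀ n x, ω n x ≠ 0)
    (hωd : ∀ i : Fin 3, ∀ n x, a i * (ω (fwd i n) x - ω n x) = θ n x * ρ (fwd i n) x)
    (hωx : ∀ n x, deriv (ω n) x = θ n x * ρ n x) :
    dpKP a (fun n x => v n x + θ n x * ρ n x / ω n x) := by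
  intro n x
  have factor := darboux_factor ha0 hθx hρx hω0 hωd
  have h12 := factor 0 1 n x
  have h13 := factor 0 2 n x
  have h13' := factor 0 2 (fwd 1 n) x
  have h12' := factor 0 1 (fwd 2 n) x
  rw [fwd_comm 2 1] at h13'
  dsimp only
  rw [h12, h13, h13', h12', mul_mul_mul_comm, hv n x, mul_mul_mul_comm _ (_ / _)]
  congr 1
  have h1 := hω0 (fwd 0 n) x
  have h2 := hω0 (fwd 1 n) x
  have h3 := hω0 (fwd 2 n) x
  have h4 := hω0 (fwd 0 (fwd 1 n)) x
  have h5 := hω0 (fwd 0 (fwd 2 n)) x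
  have h6 := hω0 (fwd 1 (fwd 2 n)) x
  field_simp
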